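/- arXiv:2403.17715 — 3 statements merged into one kernel-verified Lean document; each statement's English description precedes it below -/
import Mathlib

section
/- Let T be a tree which is not a path (i.e., has at least one vertex of degree ≥ 3). Then for every real number λ, the multiplicity m(T, λ) of λ as an eigenvalue of the adjacency matrix of T satisfies m(T, λ) ≤ p(T) - 1, where p(T) is the number of vertices of degree 1 in T. -/
open scoped Classical

/-- Multiplicity of `lam` as an eigenvalue of a real symmetric matrix:
dimension of the kernel of `A - lam • 1`. -/
noncomputable def matMult {V : Type*} [Fintype V] [DecidableEq V]
    (A : Matrix V V ℝ) (lam : ℝ) : ℕ :=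
  Module.finrank ℝ (LinearMap.ker (Matrix.toLin' (A - lam • (1 : Matrix V V ℝ))))

/-- Adjacency matrix of a simple graph over ℝ. -/
noncomputable def adjM {V : Type*} [Fintype V] (G : SimpleGraph V) : Matrix V V ℝ :=
  fun i j => if G.Adj i j then 1 else 0

/-- Multiplicity of `lam` as an eigenvalue of the adjacency matrix of `G`. -/
noncomputable def gMult {V : Type*} [Fintype V] (G : SimpleGraph V) (lam : ℝ) : ℕ :=
  matMult (adjM G) lam

/-- Multiplicity of `lam` as an eigenvalue of the induced subgraph of `G` on `s`. -/
noncomputable def sMult {V : Type*} [Fintype V] (G : SimpleGraph V) (s : Set V) (lam : ℝ) : ℕ :=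
  gMult (G.induce s) lam

/-- Degree of a vertex, via the cardinality of its neighbor set. -/
noncomputable def deg {V : Type*} (G : SimpleGraph V) (v : V) : ℕ :=
  (G.neighborSet v).ncard

/-- Number of pendant (degree-1) vertices. -/
noncomputable def pendCount {V : Type*} (G : SimpleGraph V) : ℕ :=
  {v : V | deg G v = 1}.ncard

/-- Number of pendant vertices, with the paper's convention that a
single-vertex graph has `p = 2`. -/
noncomputable def pendCount' {V : Type*} (G : SimpleGraph V) : ℕ :=
  if Nat.card V ≤ 1 then 2 else pendCount G

/-- A graph is (isomorphic to) a path graph. -/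
def IsPathGraph {W : Type*} (H : SimpleGraph W) : Prop :=
  ∃ n : ℕ, Nonempty (H ≃g SimpleGraph.pathGraph n)

/-- The vertex sets (as subsets of `V`) of the connected components of `G - w`. -/
def compSupp {V : Type*} (G : SimpleGraph V) (w : V)
    (c : (G.induce {u | u ≠ w}).ConnectedComponent) : Set V :=
  Subtype.val '' c.supp

namespace SimpleGraph

variable {V : Type*} {T : SimpleGraph V}

/-- In a tree, a vertex has at most one neighbour closer to a given root. -/
lemma IsTree.eq_of_adj_of_dist_add_one (hT : T.IsTree) {r a b w : V}
    (ha : T.Adj a w) (hb : T.Adj b w) (hda : T.dist r a + 1 = T.dist r w)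
    (hdb : T.dist r b + 1 = T.dist r w) : a = b := by
  obtain ⟨p, hp⟩ := hT.connected.exists_walk_length_eq_dist r a
  obtain ⟨q, hq⟩ := hT.connected.exists_walk_length_eq_dist r b
  have hp' := (p.concat ha).isPath_of_length_eq_dist (by simp [hp, hda])
  have hq' := (q.concat hb).isPath_of_length_eq_dist (by simp [hq, hdb])
  have h := (hT.existsUnique_path r w).unique hp' hq'
  simpa using congrArg Walk.penultimate h

/-- In a tree, a vertex other than the root all of whose neighbours are closer to the root
has degree one. -/
lemma IsTree.deg_eq_one_of_forall_adj_dist_lt (hT : T.IsTree) {r v : V} (hvr : v ≠ r)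
    (h : ∀ u, T.Adj v u → T.dist r u < T.dist r v) : deg T v = 1 := by
  obtain ⟨p⟩ := hT.connected v r
  have hadj := p.adj_snd (Walk.not_nil_of_ne hvr)
  refine Set.ncard_eq_one.mpr ⟨p.snd, Set.eq_singleton_iff_unique_mem.mpr ⟨hadj, fun u hu ↦ ?_⟩⟩
  have key : ∀ u, T.Adj v u → T.dist r u + 1 = T.dist r v := fun u hu ↦ by
    have := h u hu
    have := hT.dist_eq_dist_add_one_of_adj r hu
    omega
  exact hT.eq_of_adj_of_dist_add_one (Adj.symm hu) hadj.symm (key u hu) (key _ hadj)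

/-- An eigenvector of a tree which vanishes at all leaves but possibly one is zero. -/
lemma IsTree.eq_zero_of_eigenvector [Fintype V] [Nontrivial V] (hT : T.IsTree) {lam : ℝ}
    {x : V → ℝ} (hx : ∀ v, ∑ u, adjM T v u * x u = lam * x v) (r : V)
    (hleaf : ∀ v, deg T v = 1 → v ≠ r → x v = 0) : x = 0 := by
  have bound : ∀ v, T.dist r v ≤ ∑ u, T.dist r u := fun v ↦
    Finset.single_le_sum (fun _ _ ↦ Nat.zero_le _) (Finset.mem_univ v)
  suffices h : ∀ n v, ∑ u, T.dist r u < T.dist r v + n → x v = 0 by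
    funext v
    exact h (∑ u, T.dist r u + 1) v (by omega)
  intro n
  induction n with
  | zero =>
    intro v hv
    have := bound v
    omega
  | succ n ih =>
    intro v hv
    by_cases hc : ∃ c, T.Adj v c ∧ T.dist r v < T.dist r c
    · obtain ⟨c, hvc, hlt⟩ := hc
      have hdc : T.dist r v + 1 = T.dist r c := by
        have := hT.dist_eq_dist_add_one_of_adj r hvc
        omega
      have hsum := hx c
      rw [ih c (by omega), mul_zero, Finset.sum_eq_single v] at hsum
      · simpa [adjM, hvc.symm] using hsum
      · intro u _ huv
        by_cases hcu : T.Adj c u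
        · rw [ih u, mul_zero]
          have hne : T.dist r u + 1 ≠ T.dist r c := fun h ↦
            huv (hT.eq_of_adj_of_dist_add_one hcu.symm hvc h hdc)
          have := hT.dist_eq_dist_add_one_of_adj r hcu
          omega
        · simp [adjM, hcu]
      · simp
    · push Not at hc
      have hvr : v ≠ r := by
        rintro rfl
        obtain ⟨c, hvc⟩ := hT.connected.preconnected.exists_adj_of_nontrivial v
        have := hc c hvc
        rw [dist_self, Nat.le_zero, hT.connected.dist_eq_zero_iff] at this
        exact hvc.ne this
      refine hleaf v (hT.deg_eq_one_of_forall_adj_dist_lt hvr fun u hu ↦ ?_) hvr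
      exact lt_of_le_of_ne (hc u hu) (hT.dist_ne_of_adj r hu).symm

/-- The multiplicity of an eigenvalue of a nontrivial tree is less than the number of leaves. -/
theorem IsTree.gMult_add_one_le_pendCount [Fintype V] [Nontrivial V] (hT : T.IsTree) (lam : ℝ) :
    gMult T lam + 1 ≤ pendCount T := by
  obtain ⟨r, hr⟩ := hT.exists_vert_degree_one_of_nontrivial
  have hr' : r ∈ {v : V | deg T v = 1} := by
    rw [Set.mem_ofPred_eq, deg, Set.ncard_eq_toFinset_card']
    exact hr
  rw [pendCount, ← Set.ncard_sdiff_singleton_add_one hr', Nat.add_le_add_iff_right,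
    ← Nat.card_coe_set_eq, Nat.card_eq_fintype_card, ← Module.finrank_fintype_fun_eq_card ℝ]
  let f := (LinearMap.funLeft ℝ ℝ ((↑) : ↥({v : V | deg T v = 1} \ {r}) → V)).domRestrict
    (LinearMap.ker (Matrix.toLin' (adjM T - lam • (1 : Matrix V V ℝ))))
  refine LinearMap.finrank_le_finrank_of_injective (f := f) ?_
  refine (injective_iff_map_eq_zero f).mpr fun x hx ↦ Subtype.ext ?_
  refine hT.eq_zero_of_eigenvector (lam := lam) (fun v ↦ ?_) r fun v hv hvr ↦
    congrFun hx ⟨v, hv, hvr⟩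
  have hker := congrFun (LinearMap.mem_ker.mp x.2) v
  simpa [Matrix.toLin'_apply, Matrix.sub_mulVec, Matrix.smul_mulVec, sub_eq_zero, Matrix.mulVec,
    dotProduct] using hker

end SimpleGraph

/-- For a tree which is not a path, `m(T, lam) ≤ p(T) - 1`. -/
theorem stmt4 {V : Type*} [Fintype V] (T : SimpleGraph V) (hT : T.IsTree)
    (hmaj : ∃ v : V, 3 ≤ deg T v) (lam : ℝ) :
    gMult T lam + 1 ≤ pendCount T := by
  obtain ⟨v, hv⟩ := hmaj
  obtain ⟨u, hu⟩ : (T.neighborSet v).Nonempty := by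
    apply Set.nonempty_of_ncard_ne_zero
    change deg T v ≠ 0
    omega
  have : Nontrivial V := ⟨v, u, SimpleGraph.Adj.ne hu⟩
  exact hT.gMult_add_one_le_pendCount lam
end

section
/- Let T be a tree, v a vertex of T, and λ a real number with m(T, λ) ≥ 2. Then λ is an eigenvalue of T - v for every vertex v, and there exists a vertex w of T with degree at least 3 such that m(T - w, λ) = m(T, λ) + 1 and at least three components T_1, T_2, T_3 of T - w satisfy m(T_i, λ) ≥ 1. -/
open scoped Classical

/-- The operator `A - lam` on functions on the vertices of `G`. -/
noncomputable def adjSub {V : Type*} [Fintype V] (G : SimpleGraph V) (lam : ℝ) :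
    (V → ℝ) →ₗ[ℝ] (V → ℝ) :=
  Matrix.toLin' (adjM G - lam • (1 : Matrix V V ℝ))

lemma adjSub_apply {V : Type*} [Fintype V] (G : SimpleGraph V) (lam : ℝ) (x : V → ℝ) (u : V) :
    adjSub G lam x u = (∑ w, if G.Adj u w then x w else 0) - lam * x u := by
  simp [adjSub, Matrix.mulVec, dotProduct, adjM]

lemma sum_mul_adjSub_comm {V : Type*} [Fintype V] (G : SimpleGraph V) (lam : ℝ) (x y : V → ℝ) :
    ∑ u, x u * adjSub G lam y u = ∑ u, y u * adjSub G lam x u := by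
  simp only [adjSub_apply, mul_sub, Finset.sum_sub_distrib, Finset.mul_sum]
  congr 1
  · rw [Finset.sum_comm]
    refine Finset.sum_congr rfl fun a _ => Finset.sum_congr rfl fun b _ => ?_
    simp only [G.adj_comm a b]
    split_ifs <;> ring
  · exact Finset.sum_congr rfl fun a _ => by ring

/-- The functions supported on `S` that restrict to `lam`-eigenvectors of the subgraph induced
on `S`. -/
noncomputable def eigenOn {V : Type*} [Fintype V] (G : SimpleGraph V) (lam : ℝ) (S : Set V) :
    Submodule ℝ (V → ℝ) where
  carrier := {x | (∀ u ∉ S, x u = 0) ∧ ∀ u ∈ S, adjSub G lam x u = 0}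
  add_mem' := fun {x y} hx hy =>
    ⟨fun u hu => by simp [hx.1 u hu, hy.1 u hu], fun u hu => by simp [hx.2 u hu, hy.2 u hu]⟩
  zero_mem' := ⟨fun _ _ => rfl, fun _ _ => by simp⟩
  smul_mem' := fun a x hx =>
    ⟨fun u hu => by simp [hx.1 u hu], fun u hu => by simp [hx.2 u hu]⟩

lemma mem_eigenOn {V : Type*} [Fintype V] {G : SimpleGraph V} {lam : ℝ} {S : Set V} {x : V → ℝ} :
    x ∈ eigenOn G lam S ↔ (∀ u ∉ S, x u = 0) ∧ ∀ u ∈ S, adjSub G lam x u = 0 :=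
  Iff.rfl

lemma adjSub_induce_apply {V : Type*} [Fintype V] (G : SimpleGraph V) (lam : ℝ) (S : Set V)
    (x : V → ℝ) (hx : ∀ u ∉ S, x u = 0) (u : S) :
    adjSub (G.induce S) lam (fun s => x s) u = adjSub G lam x u := by
  simp only [adjSub_apply, SimpleGraph.comap_adj, Function.Embedding.subtype_apply]
  congr 1
  rw [Finset.sum_set_coe S (f := fun w => if G.Adj u w then x w else 0)]
  refine Finset.sum_subset (Finset.subset_univ _) fun w _ hw => ?_
  rw [hx w (by simpa using hw), ite_self]

lemma sMult_eq_finrank {V : Type*} [Fintype V] (G : SimpleGraph V) (lam : ℝ) (S : Set V) :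
    sMult G S lam = Module.finrank ℝ (eigenOn G lam S) := by
  have key : ∀ y : S → ℝ, (fun s : S => (fun u => if h : u ∈ S then y ⟨u, h⟩ else 0 : V → ℝ) s) = y :=
    fun y => by ext s; simp
  symm
  unfold sMult gMult matMult
  refine LinearEquiv.finrank_eq (R := ℝ)
    { toFun := fun x => ⟨fun s => x.1 s, ?_⟩
      invFun := fun y => ⟨fun u => if h : u ∈ S then y.1 ⟨u, h⟩ else 0, ?_, ?_⟩
      map_add' := fun x y => rfl
      map_smul' := fun a x => rfl
      left_inv := ?_
      right_inv := fun y => Subtype.ext (key y.1) }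
  · change adjSub (G.induce S) lam _ = 0
    ext s
    rw [adjSub_induce_apply G lam S x.1 x.2.1]
    exact x.2.2 s s.2
  · intro u hu
    simp [hu]
  · intro u hu
    rw [← adjSub_induce_apply G lam S _ (fun u hu => by simp [hu]) ⟨u, hu⟩, key]
    exact congrFun (LinearMap.mem_ker.1 y.2 : adjSub (G.induce S) lam y.1 = 0) _
  · intro x
    ext u
    by_cases hu : u ∈ S
    · simp [hu]
    · simp [hu, x.2.1 u hu]

lemma one_le_sMult {V : Type*} [Fintype V] {G : SimpleGraph V} {lam : ℝ} {S : Set V}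
    {x : V → ℝ} (hx : x ∈ eigenOn G lam S) (hx0 : x ≠ 0) : 1 ≤ sMult G S lam := by
  rw [sMult_eq_finrank, Nat.one_le_iff_ne_zero, Ne, Submodule.finrank_eq_zero]
  exact fun h => hx0 ((Submodule.mem_bot ℝ).1 (h ▸ hx))

/-- A nonzero eigenvector vanishing at `v` exists as soon as the multiplicity is at least two. -/
lemma exists_eigenvector_apply_eq_zero {V : Type*} [Fintype V] (G : SimpleGraph V) (lam : ℝ)
    (h : 2 ≤ gMult G lam) (v : V) : ∃ x : V → ℝ, x ≠ 0 ∧ x v = 0 ∧ adjSub G lam x = 0 := by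
  by_contra! hc
  have hinj : Function.Injective
      ((LinearMap.proj v : (V → ℝ) →ₗ[ℝ] ℝ).comp (LinearMap.ker (adjSub G lam)).subtype) := by
    rw [← LinearMap.ker_eq_bot, LinearMap.ker_eq_bot']
    intro x hx
    by_contra hx0
    exact hc x.1 (fun h => hx0 (Subtype.ext h)) hx x.2
  have := LinearMap.finrank_le_finrank_of_injective hinj
  rw [Module.finrank_self] at this
  exact absurd (h.trans this) (by norm_num)

/-- Truncating to a set `C` joined to the rest of the graph only through a vertex `v` at which
`x` vanishes. -/
lemma adjSub_indicator {V : Type*} [Fintype V] (G : SimpleGraph V) (lam : ℝ) (C : Set V) (v : V)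
    (hC : ∀ a ∈ C, ∀ b, G.Adj a b → b ∈ C ∨ b = v) (x : V → ℝ) (hxv : x v = 0) :
    (∀ u ∈ C, adjSub G lam (C.indicator x) u = adjSub G lam x u) ∧
    ∀ u ∉ C, u ≠ v → adjSub G lam (C.indicator x) u = 0 := by
  constructor
  · intro u hu
    rw [adjSub_apply, adjSub_apply, Set.indicator_of_mem hu]
    congr 1
    refine Finset.sum_congr rfl fun w _ => ?_
    split_ifs with hw
    · by_cases hwC : w ∈ C
      · simp [hwC]
      · rw [(hC u hu w hw).resolve_left hwC, hxv]
        simp [Set.indicator_apply, hxv]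
    · rfl
  · intro u hu huv
    rw [adjSub_apply, Set.indicator_of_notMem hu, mul_zero, sub_zero]
    refine Finset.sum_eq_zero fun w _ => ?_
    split_ifs with hw
    · refine Set.indicator_of_notMem (fun hwC => ?_) x
      exact (hC w hwC u hw.symm).elim hu huv
    · rfl

/-- If some vector vanishing at `v` is mapped by `A - lam` to a nonzero multiple of the indicator
of `v`, then deleting `v` raises the multiplicity by one. -/
lemma sMult_compl_eq_of_parter {V : Type*} [Fintype V] (G : SimpleGraph V) (lam : ℝ) (v : V)
    (z : V → ℝ) (hzv : z v = 0) (hz : ∀ u ≠ v, adjSub G lam z u = 0) (hz' : adjSub G lam z v ≠ 0) :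
    sMult G {u | u ≠ v} lam = gMult G lam + 1 := by
  have hzK : z ∈ eigenOn G lam {u | u ≠ v} := ⟨fun u hu => by simp_all, fun u hu => hz u hu⟩
  have hvan : ∀ x, adjSub G lam x = 0 → x v = 0 := by
    intro x hx
    have := sum_mul_adjSub_comm G lam x z
    rw [hx, Finset.sum_eq_single v (fun b _ hb => by simp [hz b hb]) (by simp)] at this
    simpa [hz'] using this
  let f : eigenOn G lam {u | u ≠ v} →ₗ[ℝ] ℝ :=
    ((LinearMap.proj v).comp (adjSub G lam)).comp (eigenOn G lam {u | u ≠ v}).subtype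
  have hf : Function.Surjective f :=
    LinearMap.surjective (f := f) fun h => hz' (LinearMap.congr_fun h ⟨z, hzK⟩)
  have hker : (LinearMap.ker f).map (eigenOn G lam {u | u ≠ v}).subtype
      = LinearMap.ker (adjSub G lam) := by
    ext x
    simp only [Submodule.mem_map, LinearMap.mem_ker, Submodule.subtype_apply, Subtype.exists,
      exists_and_right, exists_eq_right]
    constructor
    · rintro ⟨hx, hfx⟩
      ext u
      by_cases hu : u = v
      · subst hu; exact hfx
      · exact hx.2 u hu
    · intro hx
      have hxK : x ∈ eigenOn G lam {u | u ≠ v} :=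
        ⟨fun u hu => by rw [not_not.1 hu, hvan x hx],
          fun u _ => congrFun hx u⟩
      exact ⟨hxK, congrFun hx v⟩
  have hrank := LinearMap.finrank_range_add_finrank_ker f
  rw [LinearMap.range_eq_top.2 hf, finrank_top, Module.finrank_self] at hrank
  rw [sMult_eq_finrank, ← hrank, ← Submodule.finrank_map_subtype_eq, hker, add_comm]
  rfl

/-- A choice of root in a tree, with the resulting parent and depth functions. -/
structure Rooting {V : Type*} (T : SimpleGraph V) where
  root : V
  parent : V → V
  depth : V → ℕ
  adj_iff : ∀ u w, T.Adj u w ↔ (u ≠ root ∧ parent u = w) ∨ (w ≠ root ∧ parent w = u)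
  depth_eq : ∀ u ≠ root, depth u = depth (parent u) + 1
  parent_root : parent root = root

lemma SimpleGraph.IsTree.eq_of_dist_eq_add_one {V : Type*} {T : SimpleGraph V} (hT : T.IsTree)
    {r u p q : V} (hp : T.Adj p u) (hq : T.Adj q u) (hdp : T.dist r u = T.dist r p + 1)
    (hdq : T.dist r u = T.dist r q + 1) : p = q := by
  obtain ⟨P, -, hP⟩ := hT.connected.exists_path_of_dist r p
  obtain ⟨Q, -, hQ⟩ := hT.connected.exists_path_of_dist r q
  have hP' : (P.concat hp).IsPath :=
    SimpleGraph.Walk.isPath_of_length_eq_dist _ (by rw [SimpleGraph.Walk.length_concat]; omega)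
  have hQ' : (Q.concat hq).IsPath :=
    SimpleGraph.Walk.isPath_of_length_eq_dist _ (by rw [SimpleGraph.Walk.length_concat]; omega)
  have h := congrArg SimpleGraph.Walk.penultimate ((hT.existsUnique_path r u).unique hP' hQ')
  simpa using h

lemma SimpleGraph.IsTree.nonempty_rooting {V : Type*} {T : SimpleGraph V} (hT : T.IsTree) :
    Nonempty (Rooting T) := by
  obtain ⟨r⟩ := hT.connected.nonempty
  have hex : ∀ u, ∃ p, (u ≠ r → T.Adj u p ∧ T.dist r u = T.dist r p + 1) ∧ (u = r → p = r) := by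
    intro u
    by_cases hu : u = r
    · exact ⟨r, fun h => absurd hu h, fun _ => rfl⟩
    obtain ⟨P, hP, hlen⟩ := hT.connected.exists_path_of_dist r u
    have hnil : ¬ P.Nil := SimpleGraph.Walk.not_nil_of_ne (Ne.symm hu)
    have hadj := P.adj_penultimate hnil
    refine ⟨P.penultimate, fun _ => ⟨hadj.symm, ?_⟩, fun h => absurd h hu⟩
    have h1 : T.dist r P.penultimate ≤ P.dropLast.length := SimpleGraph.dist_le _
    have h2 : P.dropLast.length + 1 = P.length := SimpleGraph.Walk.length_dropLast_add_one hnil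
    have h3 := hT.dist_eq_dist_add_one_of_adj r hadj
    omega
  choose par hpar hroot using hex
  refine ⟨⟨r, par, T.dist r, fun u w => ⟨fun h => ?_, ?_⟩, fun u hu => (hpar u hu).2,
    hroot r rfl⟩⟩
  · rcases hT.dist_eq_dist_add_one_of_adj r h with hd | hd
    · have hu : u ≠ r := by rintro rfl; simp at hd
      exact Or.inl ⟨hu, hT.eq_of_dist_eq_add_one (hpar u hu).1.symm h.symm (hpar u hu).2 hd⟩
    · have hw : w ≠ r := by rintro rfl; simp at hd
      exact Or.inr ⟨hw, hT.eq_of_dist_eq_add_one (hpar w hw).1.symm h (hpar w hw).2 hd⟩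
  · rintro (⟨hu, rfl⟩ | ⟨hw, rfl⟩)
    · exact (hpar u hu).1
    · exact (hpar w hw).1.symm

namespace Rooting

variable {V : Type*} {T : SimpleGraph V} (R : Rooting T)

/-- The set of descendants of `u`, including `u`. -/
def desc (u : V) : Set V := {w | ∃ k, R.parent^[k] w = u}

lemma self_mem_desc (u : V) : u ∈ R.desc u := ⟨0, rfl⟩

lemma mem_desc_of_parent {u w : V} (h : R.parent w ∈ R.desc u) : w ∈ R.desc u := by
  obtain ⟨k, hk⟩ := h
  exact ⟨k + 1, hk⟩

lemma parent_mem_desc {u w : V} (h : w ∈ R.desc u) (hne : w ≠ u) : R.parent w ∈ R.desc u := by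
  obtain ⟨_ | k, hk⟩ := h
  · exact absurd hk hne
  · exact ⟨k, hk⟩

lemma desc_subset {u w : V} (h : w ∈ R.desc u) : R.desc w ⊆ R.desc u := by
  rintro a ⟨k, rfl⟩
  obtain ⟨l, hl⟩ := h
  exact ⟨l + k, by rw [Function.iterate_add_apply, hl]⟩

lemma depth_parent_le (u : V) : R.depth (R.parent u) ≤ R.depth u := by
  by_cases hu : u = R.root
  · rw [hu, R.parent_root]
  · rw [R.depth_eq u hu]; omega

lemma depth_le_of_mem_desc {u w : V} (h : w ∈ R.desc u) : R.depth u ≤ R.depth w := by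
  obtain ⟨k, rfl⟩ := h
  induction k with
  | zero => rfl
  | succ k ih =>
    rw [Function.iterate_succ_apply']
    exact (R.depth_parent_le _).trans ih

lemma mem_desc_root (u : V) : u ∈ R.desc R.root := by
  induction hn : R.depth u generalizing u with
  | zero =>
    by_cases hu : u = R.root
    · exact hu ▸ R.self_mem_desc _
    · have := R.depth_eq u hu; omega
  | succ n ih =>
    by_cases hu : u = R.root
    · exact hu ▸ R.self_mem_desc _
    · have := R.depth_eq u hu
      exact R.mem_desc_of_parent (ih _ (by omega))

lemma adj_parent {u : V} (hu : u ≠ R.root) : T.Adj u (R.parent u) :=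
  (R.adj_iff _ _).2 (Or.inl ⟨hu, rfl⟩)

lemma mem_desc_of_adj {c a b : V} (ha : a ∈ R.desc c) (hab : T.Adj a b) :
    b ∈ R.desc c ∨ b = R.parent c := by
  rcases (R.adj_iff a b).1 hab with ⟨-, rfl⟩ | ⟨-, rfl⟩
  · by_cases hac : a = c
    · exact Or.inr (hac ▸ rfl)
    · exact Or.inl (R.parent_mem_desc ha hac)
  · exact Or.inl (R.mem_desc_of_parent ha)

lemma parent_notMem_desc {c : V} (hc : c ≠ R.root) : R.parent c ∉ R.desc c := fun h => by
  have h1 := R.depth_le_of_mem_desc h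
  have h2 := R.depth_eq c hc
  omega

/-- The branch below `c` has a `lam`-eigenvector that does not vanish at `c`. -/
def IsDowner [Fintype V] (lam : ℝ) (c : V) : Prop :=
  ∃ x : V → ℝ, x c ≠ 0 ∧ (∀ u ∉ R.desc c, x u = 0) ∧
    ∀ u ≠ R.parent c, adjSub T lam x u = 0

/-- The vertex `p` has two distinct children that are downers. -/
def HasTwoDowners [Fintype V] (lam : ℝ) (p : V) : Prop :=
  ∃ c₁ c₂, c₁ ≠ c₂ ∧ c₁ ≠ R.root ∧ c₂ ≠ R.root ∧ R.parent c₁ = p ∧ R.parent c₂ = p ∧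
    R.IsDowner lam c₁ ∧ R.IsDowner lam c₂

lemma exists_hasTwoDowners [Fintype V] (lam : ℝ) (c : V) (x : V → ℝ) (hx0 : x ≠ 0)
    (hxc : x c = 0) (hsupp : ∀ u ∉ R.desc c, x u = 0)
    (hx : ∀ u ∈ R.desc c, adjSub T lam x u = 0) :
    ∃ p ∈ R.desc c, R.HasTwoDowners lam p := by
  obtain ⟨u₀, hu₀⟩ := Function.ne_iff.1 hx0
  obtain ⟨u, hu, hmin⟩ := Finset.exists_min_image (Finset.univ.filter fun u => x u ≠ 0) R.depth
    ⟨u₀, by simpa using hu₀⟩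
  simp only [Finset.mem_filter, Finset.mem_univ, true_and] at hu hmin
  have huc : u ∈ R.desc c := by_contra fun h => hu (hsupp u h)
  have hne : u ≠ c := fun h => hu (h ▸ hxc)
  have hpc := R.parent_mem_desc huc hne
  have hur : u ≠ R.root := by
    rintro rfl
    apply hne
    obtain ⟨k, hk⟩ := huc
    rwa [Function.iterate_fixed R.parent_root] at hk
  have hdu := R.depth_eq u hur
  have hxp : x (R.parent u) = 0 := by
    by_contra h
    have := hmin _ h
    omega
  have hsum := hx _ hpc
  rw [adjSub_apply, hxp, mul_zero, sub_zero] at hsum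
  obtain ⟨w, hwu, hw, hxw⟩ : ∃ w, w ≠ u ∧ T.Adj (R.parent u) w ∧ x w ≠ 0 := by
    by_contra! hall
    rw [Finset.sum_eq_single u (fun w _ hwu => by
      split_ifs with hw
      · exact hall w hwu hw
      · rfl) (by simp), if_pos (R.adj_parent hur).symm] at hsum
    exact hu hsum
  have hwp : w ≠ R.root ∧ R.parent w = R.parent u := by
    refine ((R.adj_iff _ _).1 hw).resolve_left fun h => ?_
    have h1 := R.depth_eq _ h.1
    rw [h.2] at h1
    have := hmin w hxw
    omega
  have hdowner : ∀ a, x a ≠ 0 → R.parent a = R.parent u → R.IsDowner lam a := by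
    intro a ha hap
    have hac : a ∈ R.desc c := by_contra fun h => ha (hsupp a h)
    have hcut := adjSub_indicator T lam (R.desc a) (R.parent a)
      (fun b hb d hbd => R.mem_desc_of_adj hb hbd) x (hap ▸ hxp)
    refine ⟨(R.desc a).indicator x, ?_, fun b hb => Set.indicator_of_notMem hb x, fun b hb => ?_⟩
    · rwa [Set.indicator_of_mem (R.self_mem_desc a)]
    · by_cases hba : b ∈ R.desc a
      · rw [hcut.1 b hba, hx b (R.desc_subset hac hba)]
      · exact hcut.2 b hba hb
  exact ⟨_, hpc, u, w, hwu.symm, hur, hwp.1, rfl, hwp.2, hdowner u hu rfl, hdowner w hxw hwp.2⟩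

lemma sMult_parent_of_isDowner [Fintype V] {lam : ℝ} {c : V} (hc : c ≠ R.root)
    (h : R.IsDowner lam c) :
    sMult T {u | u ≠ R.parent c} lam = gMult T lam + 1 := by
  obtain ⟨x, hxc, hsupp, hx⟩ := h
  have hxp := hsupp _ (R.parent_notMem_desc hc)
  refine sMult_compl_eq_of_parter T lam _ x hxp hx ?_
  rw [adjSub_apply, hxp, mul_zero, sub_zero, Finset.sum_eq_single c,
    if_pos (R.adj_parent hc).symm]
  · exact hxc
  · intro w _ hwc
    split_ifs with hw
    · refine hsupp w fun hwd => ?_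
      have h1 := R.parent_notMem_desc hc
      exact h1 (((R.adj_iff _ _).1 hw).elim (fun h => by
        have h2 := R.depth_eq _ h.1
        have h3 := R.depth_eq _ hc
        have h4 := R.depth_le_of_mem_desc hwd
        rw [h.2] at h2
        omega) fun h => h.2 ▸ R.parent_mem_desc hwd hwc)
    · rfl
  · simp

end Rooting

section Components

variable {V : Type*} {G : SimpleGraph V} {v : V}

lemma mem_compSupp {c : (G.induce {u | u ≠ v}).ConnectedComponent} {a : V} :
    a ∈ compSupp G v c ↔ ∃ h : a ≠ v, (G.induce {u | u ≠ v}).connectedComponentMk ⟨a, h⟩ = c := by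
  simp [compSupp]

lemma notMem_compSupp_self (c : (G.induce {u | u ≠ v}).ConnectedComponent) :
    v ∉ compSupp G v c := fun h => (mem_compSupp.1 h).1 rfl

lemma mem_compSupp_of_adj {c : (G.induce {u | u ≠ v}).ConnectedComponent} {a b : V}
    (ha : a ∈ compSupp G v c) (hab : G.Adj a b) : b ∈ compSupp G v c ∨ b = v := by
  by_cases hb : b = v
  · exact Or.inr hb
  obtain ⟨hav, rfl⟩ := mem_compSupp.1 ha
  refine Or.inl (mem_compSupp.2 ⟨hb, SimpleGraph.ConnectedComponent.sound ?_⟩)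
  exact SimpleGraph.Adj.reachable (show (G.induce {u | u ≠ v}).Adj ⟨b, hb⟩ ⟨a, hav⟩ from hab.symm)

lemma eq_of_mem_compSupp {c d : (G.induce {u | u ≠ v}).ConnectedComponent} {a : V}
    (hc : a ∈ compSupp G v c) (hd : a ∈ compSupp G v d) : c = d := by
  obtain ⟨_, rfl⟩ := mem_compSupp.1 hc
  exact (mem_compSupp.1 hd).2

lemma compSupp_nonempty (c : (G.induce {u | u ≠ v}).ConnectedComponent) :
    (compSupp G v c).Nonempty := c.nonempty_supp.image _

lemma exists_adj_mem_compSupp (hG : G.Connected)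
    (c : (G.induce {u | u ≠ v}).ConnectedComponent) : ∃ a ∈ compSupp G v c, G.Adj v a := by
  obtain ⟨a, ha⟩ := compSupp_nonempty c
  obtain ⟨p⟩ := hG a v
  obtain ⟨d, -, h1, h2⟩ := p.exists_boundary_dart _ ha (notMem_compSupp_self c)
  have hd : d.snd = v := (mem_compSupp_of_adj h1 d.adj).resolve_left h2
  exact ⟨d.fst, h1, hd ▸ d.adj.symm⟩

/-- A component of `G - v` meeting a set `D` that can only be left through `v` lies in `D`. -/
lemma compSupp_subset {D : Set V} (hD : ∀ a ∈ D, ∀ b, G.Adj a b → b ∈ D ∨ b = v)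
    {c : (G.induce {u | u ≠ v}).ConnectedComponent} {a : V} (ha : a ∈ compSupp G v c)
    (haD : a ∈ D) : compSupp G v c ⊆ D := by
  intro b hb
  obtain ⟨hav, rfl⟩ := mem_compSupp.1 ha
  obtain ⟨hbv, h⟩ := mem_compSupp.1 hb
  obtain ⟨p⟩ := SimpleGraph.ConnectedComponent.exact h.symm
  by_contra hbD
  obtain ⟨d, -, h1, h2⟩ := p.exists_boundary_dart (Subtype.val ⁻¹' D) haD hbD
  exact (hD _ h1 _ d.adj).elim h2 d.snd.2

lemma three_le_deg [Fintype V] (hG : G.Connected)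
    {c₁ c₂ c₃ : (G.induce {u | u ≠ v}).ConnectedComponent} (h₁₂ : c₁ ≠ c₂) (h₁₃ : c₁ ≠ c₃)
    (h₂₃ : c₂ ≠ c₃) : 3 ≤ deg G v := by
  obtain ⟨a₁, h₁, e₁⟩ := exists_adj_mem_compSupp hG c₁
  obtain ⟨a₂, h₂, e₂⟩ := exists_adj_mem_compSupp hG c₂
  obtain ⟨a₃, h₃, e₃⟩ := exists_adj_mem_compSupp hG c₃
  refine (Set.two_lt_ncard_iff (Set.toFinite _)).2 ⟨a₁, a₂, a₃, e₁, e₂, e₃, ?_, ?_, ?_⟩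
  · rintro rfl; exact h₁₂ (eq_of_mem_compSupp h₁ h₂)
  · rintro rfl; exact h₁₃ (eq_of_mem_compSupp h₁ h₃)
  · rintro rfl; exact h₂₃ (eq_of_mem_compSupp h₂ h₃)

lemma indicator_compSupp_mem_eigenOn [Fintype V] {lam : ℝ} {x : V → ℝ} (hxv : x v = 0)
    (hx : ∀ u ≠ v, adjSub G lam x u = 0) (c : (G.induce {u | u ≠ v}).ConnectedComponent) :
    (compSupp G v c).indicator x ∈ eigenOn G lam (compSupp G v c) := by
  refine ⟨fun u hu => Set.indicator_of_notMem hu x, fun u hu => ?_⟩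
  rw [(adjSub_indicator G lam _ v (fun a ha b => mem_compSupp_of_adj ha) x hxv).1 u hu]
  exact hx u (mem_compSupp.1 hu).1

end Components

/-- Parter–Wiener, part (ii), with interlacing. -/
theorem stmt6 {V : Type*} [Fintype V] (T : SimpleGraph V) (hT : T.IsTree)
    (lam : ℝ) (h : 2 ≤ gMult T lam) :
    (∀ v : V, 1 ≤ sMult T {u | u ≠ v} lam) ∧
    ∃ w : V, 3 ≤ deg T w ∧ sMult T {u | u ≠ w} lam = gMult T lam + 1 ∧
      ∃ c₁ c₂ c₃ : (T.induce {u | u ≠ w}).ConnectedComponent,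
        c₁ ≠ c₂ ∧ c₁ ≠ c₃ ∧ c₂ ≠ c₃ ∧
        1 ≤ sMult T (compSupp T w c₁) lam ∧
        1 ≤ sMult T (compSupp T w c₂) lam ∧
        1 ≤ sMult T (compSupp T w c₃) lam := by
  constructor
  · intro v
    obtain ⟨x, hx0, hxv, hx⟩ := exists_eigenvector_apply_eq_zero T lam h v
    exact one_le_sMult ⟨fun u hu => by simp_all, fun u _ => congrFun hx u⟩ hx0
  obtain ⟨R⟩ := hT.nonempty_rooting
  obtain ⟨p₀, hp₀⟩ : ∃ p, R.HasTwoDowners lam p := by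
    obtain ⟨x, hx0, hxr, hx⟩ := exists_eigenvector_apply_eq_zero T lam h R.root
    obtain ⟨p, -, hp⟩ := R.exists_hasTwoDowners lam R.root x hx0 hxr
      (fun u hu => absurd (R.mem_desc_root u) hu) (fun u _ => congrFun hx u)
    exact ⟨p, hp⟩
  obtain ⟨v, hv, hmax⟩ := Finset.exists_max_image
    (Finset.univ.filter fun p => R.HasTwoDowners lam p) R.depth ⟨p₀, by simpa using hp₀⟩
  simp only [Finset.mem_filter, Finset.mem_univ, true_and] at hv hmax
  obtain ⟨u₁, u₂, hne, hr₁, hr₂, hp₁, hp₂, hd₁, hd₂⟩ := hv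
  have hmult : sMult T {u | u ≠ v} lam = gMult T lam + 1 := by
    have := R.sMult_parent_of_isDowner hr₁ hd₁
    rwa [hp₁] at this
  have huv : ∀ {u}, u ≠ R.root → R.parent u = v → u ≠ v := fun hr hp =>
    hp ▸ (R.adj_parent hr).ne
  have hsub : ∀ {u}, R.parent u = v → ∀ {c : (T.induce {u | u ≠ v}).ConnectedComponent},
      u ∈ compSupp T v c → compSupp T v c ⊆ R.desc u := fun {u} hp c hc =>
    compSupp_subset (fun a ha b hab => hp ▸ R.mem_desc_of_adj ha hab) hc (R.self_mem_desc u)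
  have hone : ∀ {u}, u ≠ R.root → R.parent u = v → R.IsDowner lam u →
      ∀ {c : (T.induce {u | u ≠ v}).ConnectedComponent}, u ∈ compSupp T v c →
        1 ≤ sMult T (compSupp T v c) lam := by
    rintro u hr hp ⟨x, hxu, hsupp, hx⟩ c hc
    have hxv : x v = 0 := hsupp v (hp ▸ R.parent_notMem_desc hr)
    refine one_le_sMult (indicator_compSupp_mem_eigenOn hxv (hp ▸ hx) c) fun h0 => hxu ?_
    rw [← Set.indicator_of_mem hc x, h0, Pi.zero_apply]
  have hzero : ∀ {u}, u ≠ R.root → R.parent u = v →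
      ∀ {c : (T.induce {u | u ≠ v}).ConnectedComponent}, u ∈ compSupp T v c →
        ∀ x ∈ eigenOn T lam (compSupp T v c), x u = 0 → x = 0 := by
    intro u hr hp c hc x hx hxu
    by_contra hx0
    have hxv : x v = 0 := hx.1 v (notMem_compSupp_self c)
    have hself : (compSupp T v c).indicator x = x := by
      rw [Set.indicator_eq_self]
      exact fun a ha => by_contra fun h => ha (hx.1 a h)
    have hcut := adjSub_indicator T lam _ v
      (fun a (ha : a ∈ compSupp T v c) b => mem_compSupp_of_adj ha) x hxv
    obtain ⟨q, hq, hq2⟩ := R.exists_hasTwoDowners lam u x hx0 hxu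
      (fun a ha => hx.1 a fun h => ha (hsub hp hc h)) (fun a ha => by
        by_cases hac : a ∈ compSupp T v c
        · exact hx.2 a hac
        · rw [← hself]
          refine hcut.2 a hac ?_
          rintro rfl
          exact R.parent_notMem_desc hr (hp ▸ ha))
    have h1 := hmax q hq2
    have h2 := R.depth_le_of_mem_desc hq
    have h3 := R.depth_eq u hr
    rw [hp] at h3
    omega
  set c₁ := (T.induce {u | u ≠ v}).connectedComponentMk ⟨u₁, huv hr₁ hp₁⟩
  set c₂ := (T.induce {u | u ≠ v}).connectedComponentMk ⟨u₂, huv hr₂ hp₂⟩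
  have hm₁ : u₁ ∈ compSupp T v c₁ := mem_compSupp.2 ⟨huv hr₁ hp₁, rfl⟩
  have hm₂ : u₂ ∈ compSupp T v c₂ := mem_compSupp.2 ⟨huv hr₂ hp₂, rfl⟩
  have h₁₂ : c₁ ≠ c₂ := by
    intro h12
    have := R.parent_mem_desc (hsub hp₁ hm₁ (h12 ▸ hm₂)) hne.symm
    rw [hp₂, ← hp₁] at this
    exact R.parent_notMem_desc hr₁ this
  obtain ⟨c₃, h₁₃, h₂₃, hc₃⟩ : ∃ c₃, c₁ ≠ c₃ ∧ c₂ ≠ c₃ ∧ 1 ≤ sMult T (compSupp T v c₃) lam := by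
    by_contra! hall
    have hinj : Function.Injective
        (((LinearMap.proj u₁ : (V → ℝ) →ₗ[ℝ] ℝ).prod (LinearMap.proj u₂)).comp
          (eigenOn T lam {u | u ≠ v}).subtype) := by
      rw [← LinearMap.ker_eq_bot, LinearMap.ker_eq_bot']
      rintro ⟨x, hxs, hx⟩ hx12
      have hx1 : x u₁ = 0 := congrArg Prod.fst hx12
      have hx2 : x u₂ = 0 := congrArg Prod.snd hx12
      have hxv : x v = 0 := hxs v (by simp)
      have hall' : ∀ c, (compSupp T v c).indicator x = 0 := by
        intro c
        have hmem := indicator_compSupp_mem_eigenOn hxv hx c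
        by_cases h1 : c₁ = c
        · exact hzero hr₁ hp₁ (h1 ▸ hm₁) _ hmem (by simp [Set.indicator_apply, hx1])
        by_cases h2 : c₂ = c
        · exact hzero hr₂ hp₂ (h2 ▸ hm₂) _ hmem (by simp [Set.indicator_apply, hx2])
        by_contra h0
        exact absurd (one_le_sMult hmem h0) (not_le.2 (hall c h1 h2))
      ext a
      by_cases ha : a = v
      · exact ha ▸ hxv
      · have hac : a ∈ compSupp T v ((T.induce {u | u ≠ v}).connectedComponentMk ⟨a, ha⟩) :=
          mem_compSupp.2 ⟨ha, rfl⟩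
        exact (Set.indicator_of_mem hac x).symm.trans (congrFun (hall' _) a)
    have hle := LinearMap.finrank_le_finrank_of_injective hinj
    rw [Module.finrank_prod, Module.finrank_self, ← sMult_eq_finrank, hmult] at hle
    omega
  exact ⟨v, three_le_deg hT.connected h₁₂ h₁₃ h₂₃, hmult, c₁, c₂, c₃, h₁₂, h₁₃, h₂₃,
    hone hr₁ hp₁ hd₁ hm₁, hone hr₂ hp₂ hd₂ hm₂, hc₃⟩
end

section
/- Let T be a tree with p(T) ≥ 4 and m(T, λ) = p(T) - 2 for a real eigenvalue λ. Let w be a major vertex of T such that T - w has components T_1, ..., T_s. Then every component satisfies m(T_i, λ) ≥ p(T_i) - 2, where for a single-vertex component H we set p(H) = 2. -/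
open scoped Classical

/-- The `lam`-eigenspace of the adjacency matrix of `G`. -/
noncomputable def eigSpace {V : Type*} [Fintype V] (G : SimpleGraph V) (lam : ℝ) :
    Submodule ℝ (V → ℝ) :=
  LinearMap.ker (Matrix.toLin' (adjM G - lam • (1 : Matrix V V ℝ)))

theorem gMult_eq_finrank_eigSpace {V : Type*} [Fintype V] (G : SimpleGraph V) (lam : ℝ) :
    gMult G lam = Module.finrank ℝ (eigSpace G lam) := rfl

theorem mem_eigSpace {V : Type*} [Fintype V] {G : SimpleGraph V} {lam : ℝ} {x : V → ℝ} :
    x ∈ eigSpace G lam ↔ ∀ u, ∑ n, (if G.Adj u n then x n else 0) = lam * x u := by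
  unfold eigSpace
  rw [LinearMap.mem_ker, Matrix.toLin'_apply, Matrix.sub_mulVec, Matrix.smul_mulVec,
    Matrix.one_mulVec, sub_eq_zero, funext_iff]
  simp [Matrix.mulVec, dotProduct, adjM]

section Tree

variable {V : Type*} {T : SimpleGraph V}

theorem SimpleGraph.IsTree.parent_unique (hT : T.IsTree) {r u v v' : V}
    (hv : T.Adj v u) (hv' : T.Adj v' u) (hd : T.dist r u = T.dist r v + 1)
    (hd' : T.dist r u = T.dist r v' + 1) : v = v' := by
  obtain ⟨p, hp⟩ := hT.connected.exists_walk_length_eq_dist r v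
  obtain ⟨q, hq⟩ := hT.connected.exists_walk_length_eq_dist r v'
  have h1 : (p.concat hv).IsPath := (p.concat hv).isPath_of_length_eq_dist (by simp [hp, hd])
  have h2 : (q.concat hv').IsPath := (q.concat hv').isPath_of_length_eq_dist (by simp [hq, hd'])
  have h := (hT.existsUnique_path r u).unique h1 h2
  simpa using congrArg SimpleGraph.Walk.penultimate h

theorem SimpleGraph.IsTree.exists_parent (hT : T.IsTree) {r u : V} (hu : u ≠ r) :
    ∃ v, T.Adj v u ∧ T.dist r u = T.dist r v + 1 := by
  obtain ⟨p, hp⟩ := hT.connected.exists_walk_length_eq_dist u r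
  cases p with
  | nil => exact absurd rfl hu
  | @cons _ v _ h q =>
    refine ⟨v, h.symm, ?_⟩
    have h1 := SimpleGraph.dist_le q
    rw [SimpleGraph.Walk.length_cons, SimpleGraph.dist_comm] at hp
    rw [SimpleGraph.dist_comm] at h1
    rcases hT.dist_eq_dist_add_one_of_adj r h with h2 | h2 <;> omega

/-- A vertex without neighbours farther from the root is pendant. -/
theorem SimpleGraph.IsTree.deg_eq_one_of_no_child (hT : T.IsTree) {r u : V} (hu : u ≠ r)
    (h : ∀ v, T.Adj u v → T.dist r v ≠ T.dist r u + 1) : deg T u = 1 := by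
  obtain ⟨p, hp, hd⟩ := hT.exists_parent hu
  have : T.neighborSet u = {p} := by
    ext v
    rw [SimpleGraph.mem_neighborSet, Set.mem_singleton_iff]
    constructor
    · intro hv
      rcases hT.dist_eq_dist_add_one_of_adj r hv with h2 | h2
      · exact hT.parent_unique hv.symm hp h2 hd
      · exact absurd h2 (h v hv)
    · rintro rfl
      exact hp.symm
  rw [deg, this, Set.ncard_singleton]

/-- An eigenvector of a tree vanishing at all pendant vertices but one is zero. -/
theorem eq_zero_of_vanish_pendant [Fintype V] [Nontrivial V] (hT : T.IsTree) {lam : ℝ}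
    {x : V → ℝ} (hx : x ∈ eigSpace T lam) (r : V) (h : ∀ u, deg T u = 1 → u ≠ r → x u = 0) :
    x = 0 := by
  have key : ∀ k : ℕ, ∀ u, (∑ v, T.dist r v) - T.dist r u = k → x u = 0 := by
    intro k
    induction k using Nat.strong_induction_on with
    | _ k ih =>
      intro u hk
      have hle : ∀ v, T.dist r v ≤ ∑ v, T.dist r v := fun v =>
        Finset.single_le_sum (f := fun v => T.dist r v) (fun _ _ => Nat.zero_le _)
          (Finset.mem_univ v)
      have far : ∀ v, T.dist r u < T.dist r v → x v = 0 := fun v hv =>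
        ih _ (by have := hle v; omega) v rfl
      by_cases hc : ∃ v, T.Adj u v ∧ T.dist r v = T.dist r u + 1
      · obtain ⟨v, hv, hd⟩ := hc
        have e := mem_eigSpace.1 hx v
        rw [far v (by omega), mul_zero, Finset.sum_eq_single u, if_pos hv.symm] at e
        · exact e
        · intro n _ hn
          split_ifs with hvn
          · apply far
            rcases hT.dist_eq_dist_add_one_of_adj r hvn with h2 | h2
            · exact absurd (hT.parent_unique hvn.symm hv h2 hd) hn
            · omega
          · rfl
        · simp
      · push Not at hc
        by_cases hu : u = r
        · subst hu
          obtain ⟨v, hv⟩ := hT.connected.preconnected.exists_adj_of_nontrivial u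
          exact absurd (by simpa using SimpleGraph.dist_eq_one_iff_adj.2 hv) (hc v hv)
        · exact h u (hT.deg_eq_one_of_no_child hu hc) hu
  funext u
  exact key _ u rfl

/-- `C` is a union of components of `T - w` containing exactly one neighbour `v` of `w`. -/
structure IsBranch (T : SimpleGraph V) (w : V) (C : Set V) (v : V) : Prop where
  root_notMem : w ∉ C
  mem : v ∈ C
  adj : T.Adj w v
  unique : ∀ u ∈ C, T.Adj w u → u = v
  closed : ∀ u ∈ C, ∀ n, T.Adj u n → n ≠ w → n ∈ C

theorem IsBranch.exists_pendant [Fintype V] (hT : T.IsTree) {w v : V} {C : Set V}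
    (hC : IsBranch T w C v) : ∃ l ∈ C, deg T l = 1 := by
  obtain ⟨l, hl, hmax⟩ := Set.exists_max_image C (T.dist w) (Set.toFinite C) ⟨v, hC.mem⟩
  refine ⟨l, hl, hT.deg_eq_one_of_no_child (r := w) ?_ ?_⟩
  · rintro rfl
    exact hC.root_notMem hl
  · intro n hn hd
    have hnw : n ≠ w := by
      rintro rfl
      simp at hd
    have := hmax n (hC.closed l hl n hn hnw)
    omega

theorem IsBranch.pendCount_induce_le [Fintype V] {w v : V} {C : Set V}
    (hC : IsBranch T w C v) :
    pendCount (T.induce C) ≤ {u | deg T u = 1 ∧ u ∈ C}.ncard + 1 := by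
  unfold pendCount
  rw [← Set.ncard_image_of_injective _ Subtype.val_injective]
  refine (Set.ncard_le_ncard ?_ (Set.toFinite _)).trans
    (Set.ncard_insert_le v {u | deg T u = 1 ∧ u ∈ C})
  rintro _ ⟨u, hu, rfl⟩
  by_cases huv : (u : V) = v
  · exact Or.inl huv
  · refine Or.inr ⟨?_, u.2⟩
    have : T.neighborSet u = Subtype.val '' (T.induce C).neighborSet u := by
      ext n
      simp only [SimpleGraph.mem_neighborSet, Set.mem_image, SimpleGraph.comap_adj,
        Function.Embedding.subtype_apply, Subtype.exists, exists_and_right, exists_eq_right]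
      constructor
      · intro hn
        refine ⟨hC.closed u u.2 n hn ?_, hn⟩
        rintro rfl
        exact huv (hC.unique u u.2 hn.symm)
      · rintro ⟨_, hn⟩
        exact hn
    rw [deg, this, Set.ncard_image_of_injective _ Subtype.val_injective]
    exact hu

/-- Truncating an eigenvector vanishing at `w` to a branch leaves only an error at `w`. -/
theorem IsBranch.sum_indicator [Fintype V] {w v : V} {C : Set V} (hC : IsBranch T w C v)
    {lam : ℝ} {x : V → ℝ} (hx : x ∈ eigSpace T lam) (hw : x w = 0) (u : V) :
    ∑ n, (if T.Adj u n then C.indicator x n else 0) =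
      lam * C.indicator x u + if u = w then x v else 0 := by
  by_cases huw : u = w
  · subst huw
    rw [Finset.sum_eq_single v, if_pos hC.adj, if_pos rfl, Set.indicator_of_mem hC.mem,
      Set.indicator_of_notMem hC.root_notMem]
    · ring
    · intro n _ hn
      split_ifs with h
      · exact Set.indicator_of_notMem (fun hc => hn (hC.unique n hc h)) x
      · rfl
    · simp
  · rw [if_neg huw, add_zero]
    by_cases hu : u ∈ C
    · rw [Set.indicator_of_mem hu, ← mem_eigSpace.1 hx u]
      refine Finset.sum_congr rfl fun n _ => ?_
      split_ifs with h
      · by_cases hn : n = w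
        · subst hn
          rw [hw, Set.indicator_of_notMem hC.root_notMem]
        · exact Set.indicator_of_mem (hC.closed u hu n h hn) x
      · rfl
    · rw [Set.indicator_of_notMem hu, mul_zero]
      refine Finset.sum_eq_zero fun n _ => ?_
      split_ifs with h
      · exact Set.indicator_of_notMem (fun hc => hu (hC.closed n hc u h.symm huw)) x
      · rfl

theorem IsBranch.restrict_mem_eigSpace [Fintype V] {w v : V} {C : Set V} [Fintype C]
    (hC : IsBranch T w C v) {lam : ℝ} {x : V → ℝ} (hx : x ∈ eigSpace T lam) (hw : x w = 0) :
    (fun u : C => x u) ∈ eigSpace (T.induce C) lam := by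
  rw [mem_eigSpace]
  intro u
  have e := hC.sum_indicator hx hw u
  have huw : (u : V) ≠ w := by
    intro h
    exact hC.root_notMem (h ▸ u.2)
  rw [if_neg huw, add_zero, Set.indicator_of_mem u.2] at e
  rw [← e]
  have : ∀ n, (if T.Adj u n then C.indicator x n else 0) =
      C.indicator (fun n => if T.Adj u n then x n else 0) n := by
    intro n
    by_cases hn : n ∈ C <;> simp [hn]
  simp_rw [this]
  simp_rw [Set.indicator_apply]
  rw [← Finset.sum_filter, Finset.sum_subtype _ (p := (· ∈ C)) (F := ‹Fintype C›) (by simp)]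
  exact Finset.sum_congr (by ext; simp) fun n _ => by simp

theorem IsBranch.indicator_mem_eigSpace [Fintype V] {w v : V} {C : Set V}
    (hC : IsBranch T w C v) {lam : ℝ} {x : V → ℝ} (hx : x ∈ eigSpace T lam) (hw : x w = 0)
    (hv : x v = 0) : C.indicator x ∈ eigSpace T lam := by
  rw [mem_eigSpace]
  intro u
  rw [hC.sum_indicator hx hw u, hv, ite_self, add_zero]

/-- If some eigenvector is nonzero at `w`, then every eigenvector vanishing at `w` vanishes at
the neighbours of `w`. -/
theorem IsBranch.apply_eq_zero [Fintype V] {w v : V} {C : Set V} (hC : IsBranch T w C v)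
    {lam : ℝ} {x y : V → ℝ} (hx : x ∈ eigSpace T lam) (hw : x w = 0)
    (hy : y ∈ eigSpace T lam) (hyw : y w ≠ 0) : x v = 0 := by
  have h1 : ∑ u, y u * ∑ n, (if T.Adj u n then C.indicator x n else 0) =
      ∑ u, C.indicator x u * ∑ n, (if T.Adj u n then y n else 0) := by
    simp_rw [Finset.mul_sum]
    rw [Finset.sum_comm]
    refine Finset.sum_congr rfl fun u _ => Finset.sum_congr rfl fun n _ => ?_
    simp only [T.adj_comm n u]
    split_ifs <;> ring
  simp_rw [hC.sum_indicator hx hw, mem_eigSpace.1 hy, mul_add, Finset.sum_add_distrib] at h1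
  have h2 : ∑ u, y u * (lam * C.indicator x u) = ∑ u, C.indicator x u * (lam * y u) :=
    Finset.sum_congr rfl fun u _ => by ring
  rw [h2] at h1
  simpa [hyw] using h1

/-- Dimension bound from a set `L` which, together with the branch `C`, determines the
eigenvectors vanishing at `w`. -/
theorem IsBranch.finrank_le [Fintype V] {w v : V} {C : Set V} (hC : IsBranch T w C v)
    {lam : ℝ} (K : Submodule ℝ (V → ℝ)) (hK : K ≤ eigSpace T lam) (hKw : ∀ x ∈ K, x w = 0)
    (L : Finset V) (hL : ∀ x ∈ K, (∀ u ∈ C, x u = 0) → (∀ u ∈ L, x u = 0) → x = 0) :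
    Module.finrank ℝ K ≤ sMult T C lam + L.card := by
  let f : K →ₗ[ℝ] eigSpace (T.induce C) lam :=
    ((LinearMap.funLeft ℝ ℝ (Subtype.val : C → V)).comp K.subtype).codRestrict _
      fun x => hC.restrict_mem_eigSpace (hK x.2) (hKw x x.2)
  let g : K →ₗ[ℝ] (L → ℝ) := (LinearMap.funLeft ℝ ℝ (Subtype.val : L → V)).comp K.subtype
  have hinj : Function.Injective (f.prod g) := by
    rw [injective_iff_map_eq_zero]
    intro x hx
    obtain ⟨hf, hg⟩ := Prod.mk.inj hx
    refine Subtype.ext (hL x x.2 (fun u hu => ?_) fun u hu => ?_)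
    · exact congrFun (congrArg Subtype.val hf) ⟨u, hu⟩
    · exact congrFun hg ⟨u, hu⟩
  have h := LinearMap.finrank_le_finrank_of_injective hinj
  rw [Module.finrank_prod, Module.finrank_fintype_fun_eq_card, Fintype.card_coe] at h
  exact h

theorem finrank_le_finrank_inf_ker_add_one {E : Type*} [AddCommGroup E] [Module ℝ E]
    [FiniteDimensional ℝ E] (K : Submodule ℝ E) (φ : E →ₗ[ℝ] ℝ) :
    Module.finrank ℝ K ≤ Module.finrank ℝ (K ⊓ LinearMap.ker φ : Submodule ℝ E) + 1 := by
  have h1 := Submodule.finrank_sup_add_finrank_inf_eq K (LinearMap.ker φ)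
  have h2 := φ.finrank_range_add_finrank_ker
  have h3 : Module.finrank ℝ (LinearMap.range φ) ≤ 1 := by
    simpa using Submodule.finrank_le (LinearMap.range φ)
  have h4 := Submodule.finrank_le (K ⊔ LinearMap.ker φ)
  omega

/-- In a tree, the component of `v` in `T - w` is a branch at `v`. -/
theorem isBranch_compSupp (hT : T.IsTree) {w v : V} (h : T.Adj w v) :
    IsBranch T w (compSupp T w ((T.induce {u | u ≠ w}).connectedComponentMk ⟨v, h.ne'⟩)) v where
  root_notMem := by
    rintro ⟨u, _, hu⟩
    exact u.2 hu
  mem := ⟨⟨v, h.ne'⟩, rfl, rfl⟩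
  adj := h
  unique := by
    rintro _ ⟨u, hu, rfl⟩ hwu
    have hr : (T.induce {u | u ≠ w}).Reachable u ⟨v, h.ne'⟩ :=
      SimpleGraph.ConnectedComponent.exact hu
    obtain ⟨p, hp⟩ := hr.exists_isPath
    have hp' : (p.map (SimpleGraph.Embedding.induce {u | u ≠ w}).toHom).IsPath :=
      hp.map Subtype.val_injective
    have hnot : w ∉ (p.map (SimpleGraph.Embedding.induce {u | u ≠ w}).toHom).support := by
      rw [SimpleGraph.Walk.support_map]
      intro hm
      obtain ⟨z, _, hz⟩ := List.mem_map.1 hm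
      exact z.2 hz
    have h1 := hp'.cons (h := hwu) hnot
    have h2 : (SimpleGraph.Walk.cons h SimpleGraph.Walk.nil).IsPath := by
      simp [h.ne]
    have e := (hT.existsUnique_path w v).unique h1 h2
    exact (SimpleGraph.Walk.snd_cons _ hwu).symm.trans (congrArg SimpleGraph.Walk.snd e)
  closed := by
    rintro _ ⟨u, hu, rfl⟩ n hn hnw
    refine ⟨⟨n, hnw⟩, ?_, rfl⟩
    rw [SimpleGraph.ConnectedComponent.mem_supp_iff] at hu ⊢
    rw [← hu]
    exact SimpleGraph.ConnectedComponent.sound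
      (SimpleGraph.Adj.reachable (G := T.induce {u | u ≠ w}) (u := ⟨n, hnw⟩) (v := u) hn.symm)

theorem exists_adj_connectedComponentMk_eq (hT : T.IsTree) {w : V}
    (c : (T.induce {u | u ≠ w}).ConnectedComponent) :
    ∃ (v : V) (h : T.Adj w v), (T.induce {u | u ≠ w}).connectedComponentMk ⟨v, h.ne'⟩ = c := by
  induction c using SimpleGraph.ConnectedComponent.ind with
  | _ u =>
    have key : ∀ k : ℕ, ∀ u : {u | u ≠ w}, T.dist w u = k → ∃ (v : V) (h : T.Adj w v),
        (T.induce {u | u ≠ w}).connectedComponentMk ⟨v, h.ne'⟩ =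
          (T.induce {u | u ≠ w}).connectedComponentMk u := by
      intro k
      induction k with
      | zero =>
        intro u hu
        exact absurd (hT.connected.dist_eq_zero_iff.1 hu).symm u.2
      | succ k ih =>
        intro u hu
        obtain ⟨p, hp, hd⟩ := hT.exists_parent (r := w) (u := u) u.2
        by_cases hpw : p = w
        · subst hpw
          exact ⟨u, hp, rfl⟩
        · obtain ⟨v, h, e⟩ := ih ⟨p, hpw⟩ (by simp only; omega)
          refine ⟨v, h, e.trans (SimpleGraph.ConnectedComponent.sound ?_)⟩
          exact SimpleGraph.Adj.reachable (G := T.induce {u | u ≠ w}) (u := ⟨p, hpw⟩) (v := u) hp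
    exact key _ u rfl

theorem disjoint_compSupp {w : V} {c d : (T.induce {u | u ≠ w}).ConnectedComponent}
    (h : c ≠ d) : Disjoint (compSupp T w c) (compSupp T w d) := by
  refine (Set.disjoint_image_iff Subtype.val_injective).2 ?_
  exact SimpleGraph.pairwise_disjoint_supp_connectedComponent _ h

/-- If a tree has three pairwise disjoint branches at `w`, then its eigenvalue multiplicity is
controlled by one branch and the pendant vertices outside it. -/
theorem gMult_add_ncard_pendant_le [Fintype V] (hT : T.IsTree) {lam : ℝ} {w v v₁ v₂ : V}
    {C C₁ C₂ : Set V} (hC : IsBranch T w C v) (hC₁ : IsBranch T w C₁ v₁)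
    (hC₂ : IsBranch T w C₂ v₂) (h₁ : Disjoint C C₁) (h₂ : Disjoint C C₂)
    (h₁₂ : Disjoint C₁ C₂) :
    gMult T lam + {u | deg T u = 1 ∧ u ∈ C}.ncard + 1 ≤ sMult T C lam + pendCount T := by
  have : Nontrivial V := ⟨w, v, hC.adj.ne⟩
  obtain ⟨l₁, hl₁, hd₁⟩ := hC₁.exists_pendant hT
  obtain ⟨l₂, hl₂, hd₂⟩ := hC₂.exists_pendant hT
  have hlC₁ : l₁ ∉ C := Set.disjoint_right.1 h₁ hl₁
  have hlC₂ : l₂ ∉ C := Set.disjoint_right.1 h₂ hl₂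
  have hl : l₁ ≠ l₂ := by
    rintro rfl
    exact Set.disjoint_left.1 h₁₂ hl₁ hl₂
  set P : Finset V := Finset.univ.filter fun u => deg T u = 1 ∧ u ∉ C with hP
  have hcard : {u | deg T u = 1 ∧ u ∈ C}.ncard + P.card = pendCount T := by
    have e1 : {u | deg T u = 1 ∧ u ∈ C}.ncard =
        (Finset.univ.filter fun u => deg T u = 1 ∧ u ∈ C).card := by
      rw [← Set.ncard_coe_finset]
      simp
    have e2 : pendCount T = (Finset.univ.filter fun u => deg T u = 1).card := by
      rw [pendCount, ← Set.ncard_coe_finset]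
      simp
    rw [e1, e2, hP, ← Finset.filter_filter, ← Finset.filter_filter,
      Finset.card_filter_add_card_filter_not]
  have hl₁P : l₁ ∈ P := by simp [hP, hd₁, hlC₁]
  have hl₂P : l₂ ∈ P.erase l₁ := by simp [hP, hd₂, hlC₂, hl.symm]
  have c₁ := Finset.card_erase_add_one hl₁P
  have c₂ := Finset.card_erase_add_one hl₂P
  rw [gMult_eq_finrank_eigSpace]
  by_cases hall : ∀ x ∈ eigSpace T lam, x w = 0
  · have := hC.finrank_le (eigSpace T lam) le_rfl hall (P.erase l₁) fun x hx hxC hxL =>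
      eq_zero_of_vanish_pendant hT hx l₁ fun u hu hul => by
        by_cases huC : u ∈ C
        · exact hxC u huC
        · exact hxL u (by simp [hP, hu, huC, hul])
    omega
  · push Not at hall
    obtain ⟨y, hy, hyw⟩ := hall
    have hK := finrank_le_finrank_inf_ker_add_one (eigSpace T lam)
      (LinearMap.proj w : (V → ℝ) →ₗ[ℝ] ℝ)
    have := hC.finrank_le (eigSpace T lam ⊓ LinearMap.ker (LinearMap.proj w : (V → ℝ) →ₗ[ℝ] ℝ))
      inf_le_left (fun x hx => hx.2) ((P.erase l₁).erase l₂) fun x hx hxC hxL => by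
        obtain ⟨hx, hxw⟩ := hx
        replace hxw : x w = 0 := hxw
        have hz := hC₁.indicator_mem_eigSpace hx hxw (hC₁.apply_eq_zero hx hxw hy hyw)
        have hvan : ∀ u, deg T u = 1 → u ≠ l₁ → u ≠ l₂ → x u = 0 := by
          intro u hu hu₁ hu₂
          by_cases huC : u ∈ C
          · exact hxC u huC
          · exact hxL u (by simp [hP, hu, huC, hu₁, hu₂])
        have hz0 := eq_zero_of_vanish_pendant hT hz l₁ fun u hu hu₁ => by
          by_cases huC : u ∈ C₁
          · rw [Set.indicator_of_mem huC]
            refine hvan u hu hu₁ ?_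
            rintro rfl
            exact Set.disjoint_left.1 h₁₂ huC hl₂
          · exact Set.indicator_of_notMem huC x
        refine eq_zero_of_vanish_pendant hT hx l₂ fun u hu hu₂ => ?_
        by_cases hu₁ : u = l₁
        · subst hu₁
          simpa [hl₁] using congrFun hz0 u
        · exact hvan u hu hu₁ hu₂
    omega

end Tree

/-- Claim 2: every component of `T - w` satisfies `m(Tᵢ, lam) ≥ p(Tᵢ) - 2`
(with the convention `p = 2` for a single-vertex component). -/
theorem stmt15 {V : Type*} [Fintype V] (T : SimpleGraph V) (hT : T.IsTree)
    (lam : ℝ) (hp : 4 ≤ pendCount T) (hm : gMult T lam + 2 = pendCount T)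
    (w : V) (hw : 3 ≤ deg T w) :
    ∀ c : (T.induce {u | u ≠ w}).ConnectedComponent,
      pendCount' (T.induce (compSupp T w c)) ≤
        sMult T (compSupp T w c) lam + 2 := by
  intro c
  obtain ⟨v, h, rfl⟩ := exists_adj_connectedComponentMk_eq hT c
  have hC := isBranch_compSupp hT h
  have hlt : ({v} : Set V).ncard < (T.neighborSet w).ncard := by
    rw [Set.ncard_singleton]
    exact lt_of_lt_of_le (by norm_num) hw
  obtain ⟨v₁, hv₁, hne₁⟩ := Set.exists_mem_notMem_of_ncard_lt_ncard hlt
  have hlt₂ : ({v, v₁} : Set V).ncard < (T.neighborSet w).ncard :=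
    lt_of_le_of_lt (Set.ncard_insert_le v {v₁}) (by
      rw [Set.ncard_singleton]
      exact lt_of_lt_of_le (by norm_num) hw)
  obtain ⟨v₂, hv₂, hne₂⟩ := Set.exists_mem_notMem_of_ncard_lt_ncard hlt₂
  simp only [Set.mem_insert_iff, Set.mem_singleton_iff, not_or] at hne₁ hne₂
  have hC₁ := isBranch_compSupp hT hv₁
  have hC₂ := isBranch_compSupp hT hv₂
  have disj : ∀ {a b : V} (ha : T.Adj w a) (hb : T.Adj w b), b ≠ a →
      Disjoint (compSupp T w ((T.induce {u | u ≠ w}).connectedComponentMk ⟨a, ha.ne'⟩))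
        (compSupp T w ((T.induce {u | u ≠ w}).connectedComponentMk ⟨b, hb.ne'⟩)) := by
    intro a b ha hb hab
    apply disjoint_compSupp
    intro e
    have hm := (isBranch_compSupp hT hb).mem
    rw [← e] at hm
    exact hab ((isBranch_compSupp hT ha).unique b hm hb)
  have hmain := gMult_add_ncard_pendant_le (lam := lam) hT hC hC₁ hC₂ (disj h hv₁ hne₁)
    (disj h hv₂ hne₂.1) (disj hv₁ hv₂ hne₂.2)
  have hpend := hC.pendCount_induce_le
  unfold pendCount'
  split_ifs
  · omega
  · omega
end
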